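/- arXiv:1112.0147 — 2 statements merged into one kernel-verified Lean document; each statement's English description precedes it below -/
import Mathlib

section
/- For every λ-integrable function f : X → ℂ, the function (n, x) ↦ ∏_{i : Fin n} f(x_i) is μ-integrable on the Guichardet space Ω and ∫_Ω ∏_{i} f(x_i) dμ(n, x) = exp(∫_X f dλ); equivalently, ∑_{n=0}^{∞} (1/n!) ∫_{Fin n → X} ∏_{i} f(x_i) dλ^{⊗n} = exp(∫_X f dλ). -/
open MeasureTheory ENNReal

noncomputable section

/-- The Guichardet space over `X`. -/
abbrev GS (X : Type*) := Σ n : ℕ, Fin n → X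

/-- The Guichardet measure `μ = ∑ₙ (1/n!)·(Sigma.mk n)_* λ^{⊗n}`. -/
def guichardetMeasure {X : Type*} [MeasurableSpace X] (lam : Measure X) : Measure (GS X) :=
  Measure.sum fun n =>
    ((n.factorial : ℝ≥0∞))⁻¹ • Measure.map (Sigma.mk n) (Measure.pi fun _ : Fin n => lam)

theorem measurableEmbedding_sigmaMk {ι : Type*} {β : ι → Type*} [∀ i, MeasurableSpace (β i)]
    (i : ι) : MeasurableEmbedding (Sigma.mk i : β i → Sigma β) where
  injective := sigma_mk_injective
  measurable := fun _ hs => MeasurableSpace.measurableSet_iInf.1 hs i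
  measurableSet_image' := by
    intro s hs
    refine MeasurableSpace.measurableSet_iInf.2 fun j => ?_
    change MeasurableSet (Sigma.mk j ⁻¹' (Sigma.mk i '' s))
    by_cases h : i = j
    · subst h
      rwa [Set.preimage_image_eq _ sigma_mk_injective]
    · rw [Set.preimage_image_sigmaMk_of_ne (Ne.symm h)]
      exact MeasurableSet.empty

/-- The integral against the `n`-particle component of the Guichardet measure. -/
theorem integral_guichardet_component {X E : Type*} [MeasurableSpace X] [NormedAddCommGroup E]
    [NormedSpace ℝ E] (lam : Measure X) (n : ℕ) (g : GS X → E) :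
    ∫ ϑ, g ϑ ∂((n.factorial : ℝ≥0∞)⁻¹ •
        Measure.map (Sigma.mk n) (Measure.pi fun _ : Fin n => lam))
      = (n.factorial : ℝ)⁻¹ • ∫ y, g ⟨n, y⟩ ∂(Measure.pi fun _ : Fin n => lam) := by
  rw [integral_smul_measure, (measurableEmbedding_sigmaMk n).integral_map]
  simp

theorem integrable_prod_guichardetMeasure {X : Type*} [MeasurableSpace X] (lam : Measure X)
    [SigmaFinite lam] {f : X → ℂ} (hf : Integrable f lam) :
    Integrable (fun ϑ : GS X => ∏ i : Fin ϑ.1, f (ϑ.2 i)) (guichardetMeasure lam) := by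
  refine integrable_sum_measure (fun n => ?_) ?_
  · refine Integrable.smul_measure ?_ (by simp [Nat.factorial_ne_zero])
    rw [(measurableEmbedding_sigmaMk n).integrable_map_iff]
    exact Integrable.fintype_prod fun _ => hf
  · simp_rw [integral_guichardet_component, norm_prod]
    have h (n : ℕ) := integral_fintype_prod_eq_pow (ι := Fin n) (fun x => ‖f x‖) (μ := lam)
    simp only [Fintype.card_fin] at h
    simp_rw [h, smul_eq_mul, inv_mul_eq_div]
    exact Real.summable_pow_div_factorial _

/-- For `λ`-integrable `f : X → ℂ`, the function `(n,x) ↦ ∏ᵢ f(xᵢ)` is `μ`-integrable on the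
Guichardet space and `∫ ∏ᵢ f(xᵢ) dμ = exp (∫ f dλ)`; equivalently
`∑ₙ (1/n!) ∫ ∏ᵢ f(xᵢ) dλ^{⊗n} = exp (∫ f dλ)`. -/
theorem stmt2 {X : Type*} [MeasurableSpace X] (lam : Measure X) [SigmaFinite lam]
    (f : X → ℂ) (hf : Integrable f lam) :
    Integrable (fun ϑ : GS X => ∏ i : Fin ϑ.1, f (ϑ.2 i)) (guichardetMeasure lam)
    ∧
    ∫ ϑ : GS X, ∏ i : Fin ϑ.1, f (ϑ.2 i) ∂(guichardetMeasure lam)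
      = Complex.exp (∫ x, f x ∂lam)
    ∧
    ∑' n : ℕ, (n.factorial : ℂ)⁻¹ *
        ∫ y : Fin n → X, ∏ i : Fin n, f (y i) ∂(Measure.pi fun _ : Fin n => lam)
      = Complex.exp (∫ x, f x ∂lam) := by
  have hint := integrable_prod_guichardetMeasure lam hf
  have hsum : ∑' n : ℕ, (n.factorial : ℂ)⁻¹ *
        ∫ y : Fin n → X, ∏ i : Fin n, f (y i) ∂(Measure.pi fun _ : Fin n => lam)
      = Complex.exp (∫ x, f x ∂lam) := by
    simp_rw [integral_fintype_prod_eq_pow, Fintype.card_fin, inv_mul_eq_div]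
    rw [Complex.exp_eq_exp_ℂ]
    exact (NormedSpace.expSeries_div_hasSum_exp _).tsum_eq
  refine ⟨hint, ?_, hsum⟩
  rw [← hsum, guichardetMeasure, integral_sum_measure hint]
  refine tsum_congr fun n => ?_
  rw [integral_guichardet_component, Complex.real_smul]
  push_cast
  rfl
end
end

section
/- Let q₀, q₁ : X → (0,∞) and q : X → (0,∞) be measurable with q₀(x) + q₁(x) ≤ q(x) for λ-a.e. x. Let ψ : Ω × Ω → H be measurable and symmetric in each of its two arguments, and define the multiple point integral Δ*ψ : Ω → H by (Δ*ψ)(n, x) = ∑_{S ⊆ Fin n} ψ((|S|, x|_S), (n − |S|, x|_{S^c})). Then ∫_Ω ‖(Δ*ψ)(ϑ)‖² (q⁻¹)^⊗(ϑ) dμ(ϑ) ≤ ∫_{Ω × Ω} ‖ψ(υ, κ)‖² (q₀⁻¹)^⊗(υ) (q₁⁻¹)^⊗(κ) d(μ ⊗ μ)(υ, κ). (The adjoint Δ* of the multiple point splitter is a contraction from the tensor product of the weighted Fock spaces with weights q₀⁻¹, q₁⁻¹ into the weighted Fock space with weight q⁻¹, for every q ≥ q₀ + q₁.) -/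
open MeasureTheory ENNReal
open scoped NNReal

noncomputable section

/-- The product weight `q^⊗(n,x) = ∏ᵢ q(xᵢ)`. -/
def prodWeight {X : Type*} (q : X → ℝ≥0) (ϑ : GS X) : ℝ≥0∞ :=
  ∏ i : Fin ϑ.1, (q (ϑ.2 i) : ℝ≥0∞)

/-- A function on the Guichardet space is symmetric if it is invariant under permutations
of the coordinates. -/
def SymmFun {X E : Type*} (χ : GS X → E) : Prop :=
  ∀ (n : ℕ) (σ : Equiv.Perm (Fin n)) (x : Fin n → X), χ ⟨n, x ∘ σ⟩ = χ ⟨n, x⟩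

/-- Restriction of `x : Fin n → X` to a subset `S` of cardinality `m`,
coordinates taken in increasing index order. -/
def restrOf {X : Type*} {n m : ℕ} (S : Finset (Fin n)) (hS : S.card = m) (x : Fin n → X) :
    Fin m → X := fun i => x (S.orderIsoOfFin hS i)

/-- The adjoint `Δ*` of the multiple point splitter,
`(Δ*ψ)(n,x) = ∑_{S ⊆ Fin n} ψ((|S|, x|_S), (n−|S|, x|_{Sᶜ}))`. -/
def splitterAdjoint {X H : Type*} [AddCommMonoid H] (ψ : GS X × GS X → H) (ϑ : GS X) : H :=
  ∑ S : Finset (Fin ϑ.1),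
    ψ (⟨S.card, restrOf S rfl ϑ.2⟩,
       ⟨ϑ.1 - S.card, restrOf Sᶜ (by simp [Finset.card_compl]) ϑ.2⟩)

theorem measurable_of_sigma {ι : Type*} {β : ι → Type*} [∀ i, MeasurableSpace (β i)] {E : Type*}
    [MeasurableSpace E] {f : (Σ i, β i) → E} (hf : ∀ i, Measurable fun x => f ⟨i, x⟩) :
    Measurable f := fun _ hs =>
  MeasurableSpace.measurableSet_iInf.2 fun i => hf i hs

theorem measurable_sigma_mk {ι : Type*} {β : ι → Type*} [∀ i, MeasurableSpace (β i)] (i : ι) :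
    Measurable (Sigma.mk i : β i → Σ i, β i) := fun _ hs =>
  MeasurableSpace.measurableSet_iInf.1 hs i

theorem measurable_comp_sigmaMk_prod {X E : Type*} [MeasurableSpace X] [MeasurableSpace E]
    {F : GS X × GS X → E} (hF : Measurable F) (m k : ℕ) :
    Measurable fun p : (Fin m → X) × (Fin k → X) => F (⟨m, p.1⟩, ⟨k, p.2⟩) :=
  hF.comp (((measurable_sigma_mk m).comp measurable_fst).prodMk
    ((measurable_sigma_mk k).comp measurable_snd))

theorem measurable_prodWeight {X : Type*} [MeasurableSpace X] {q : X → ℝ≥0} (hq : Measurable q) :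
    Measurable (prodWeight q) :=
  measurable_of_sigma fun n => by
    unfold prodWeight
    exact Finset.measurable_fun_prod Finset.univ fun (i : Fin n) _ =>
      (hq.comp (measurable_pi_apply (X := fun _ => X) i)).coe_nnreal_ennreal

theorem prod_restrOf {X M : Type*} [CommMonoid M] {n m : ℕ} (S : Finset (Fin n)) (hS : S.card = m)
    (x : Fin n → X) (f : X → M) : ∏ i, f (restrOf S hS x i) = ∏ i ∈ S, f (x i) := by
  rw [← Finset.prod_coe_sort S]
  exact (S.orderIsoOfFin hS).toEquiv.prod_comp fun i : S => f (x i)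

theorem measurePreserving_restrOf {X : Type*} [MeasurableSpace X] (lam : Measure X)
    [SigmaFinite lam] {n m k : ℕ} (S : Finset (Fin n)) (hm : S.card = m) (hk : Sᶜ.card = k) :
    MeasurePreserving (fun x : Fin n → X => (restrOf S hm x, restrOf Sᶜ hk x))
      (Measure.pi fun _ => lam) ((Measure.pi fun _ => lam).prod (Measure.pi fun _ => lam)) :=
  (measurePreserving_sumPiEquivProdPi fun _ : Fin m ⊕ Fin k => lam).comp
    (measurePreserving_piCongrLeft (fun _ : Fin n => lam) (finSumEquivOfFinset hm hk)).symm

theorem lintegral_guichardetMeasure {X : Type*} [MeasurableSpace X] (lam : Measure X)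
    {f : GS X → ℝ≥0∞} (hf : Measurable f) :
    ∫⁻ ϑ, f ϑ ∂guichardetMeasure lam =
      ∑' n : ℕ, (n.factorial : ℝ≥0∞)⁻¹ * ∫⁻ x, f ⟨n, x⟩ ∂Measure.pi fun _ : Fin n => lam := by
  unfold guichardetMeasure
  rw [lintegral_sum_measure]
  refine tsum_congr fun n => ?_
  rw [lintegral_smul_measure, lintegral_map hf (measurable_sigma_mk n), smul_eq_mul]

theorem lintegral_guichardetMeasure_le {X : Type*} [MeasurableSpace X] (lam : Measure X)
    (f : GS X → ℝ≥0∞) :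
    ∫⁻ ϑ, f ϑ ∂guichardetMeasure lam ≤
      ∑' n : ℕ, (n.factorial : ℝ≥0∞)⁻¹ * ∫⁻ x, f ⟨n, x⟩ ∂Measure.pi fun _ : Fin n => lam := by
  unfold guichardetMeasure
  rw [lintegral_sum_measure]
  refine ENNReal.tsum_le_tsum fun n => ?_
  rw [lintegral_smul_measure, smul_eq_mul]
  gcongr
  exact lintegral_map_le f _

theorem sFinite_guichardetMeasure {X : Type*} [MeasurableSpace X] (lam : Measure X)
    [SigmaFinite lam] : SFinite (guichardetMeasure lam) := by
  unfold guichardetMeasure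
  infer_instance

theorem lintegral_prod_guichardetMeasure {X : Type*} [MeasurableSpace X] (lam : Measure X)
    [SigmaFinite lam] {F : GS X × GS X → ℝ≥0∞} (hF : Measurable F) :
    ∫⁻ p, F p ∂(guichardetMeasure lam).prod (guichardetMeasure lam) =
      ∑' m : ℕ, ∑' k : ℕ, (m.factorial : ℝ≥0∞)⁻¹ * (k.factorial : ℝ≥0∞)⁻¹ *
        ∫⁻ p, F (⟨m, p.1⟩, ⟨k, p.2⟩)
          ∂(Measure.pi fun _ : Fin m => lam).prod (Measure.pi fun _ : Fin k => lam) := by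
  have := sFinite_guichardetMeasure lam
  have hmk := measurable_comp_sigmaMk_prod hF
  rw [lintegral_prod _ hF.aemeasurable,
    lintegral_guichardetMeasure lam hF.lintegral_prod_right']
  refine tsum_congr fun m => ?_
  have hk (x : Fin m → X) := lintegral_guichardetMeasure lam
    (hF.comp (measurable_prodMk_left (x := (⟨m, x⟩ : GS X))))
  simp only [Function.comp_def] at hk
  simp_rw [hk]
  rw [lintegral_tsum fun k => ((hmk m k).lintegral_prod_right'.const_mul _).aemeasurable,
    ← ENNReal.tsum_mul_left]
  refine tsum_congr fun k => ?_
  rw [lintegral_const_mul _ (hmk m k).lintegral_prod_right',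
    lintegral_prod _ (hmk m k).aemeasurable, mul_assoc]

theorem tsum_tsum_eq_tsum_sum_range (g : ℕ → ℕ → ℝ≥0∞) :
    ∑' m, ∑' k, g m k = ∑' n, ∑ m ∈ Finset.range (n + 1), g m (n - m) := by
  rw [← ENNReal.tsum_prod, ← Finset.HasAntidiagonal.sigmaAntidiagonalEquivProd.tsum_eq,
    ENNReal.tsum_sigma']
  refine tsum_congr fun n => ?_
  rw [← Finset.Nat.sum_antidiagonal_eq_sum_range_succ_mk (fun p : ℕ × ℕ => g p.1 p.2),
    tsum_fintype]
  exact Finset.sum_coe_sort (Finset.HasAntidiagonal.antidiagonal n) fun p : ℕ × ℕ => g p.1 p.2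

theorem inv_factorial_mul_choose {n m : ℕ} (h : m ≤ n) :
    (n.factorial : ℝ≥0∞)⁻¹ * n.choose m =
      (m.factorial : ℝ≥0∞)⁻¹ * ((n - m).factorial : ℝ≥0∞)⁻¹ := by
  have h0 (j : ℕ) : (j.factorial : ℝ≥0∞) ≠ 0 := by exact_mod_cast j.factorial_ne_zero
  have ht (j : ℕ) : (j.factorial : ℝ≥0∞) ≠ ∞ := ENNReal.natCast_ne_top _
  rw [← ENNReal.mul_inv (.inl (h0 m)) (.inl (ht m)), mul_comm, ← div_eq_mul_inv, ← one_div,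
    ENNReal.div_eq_div_iff (mul_ne_zero (h0 _) (h0 _)) (ENNReal.mul_ne_top (ht _) (ht _))
      (h0 n) (ht n)]
  exact_mod_cast (by rw [← Nat.choose_mul_factorial_mul_factorial h]; ring)

/-- The sum-integral identity of Guichardet spaces, as an equality of lower integrals. -/
theorem tsum_lintegral_splitterAdjoint {X : Type*} [MeasurableSpace X] (lam : Measure X)
    [SigmaFinite lam] {F : GS X × GS X → ℝ≥0∞} (hF : Measurable F) :
    ∑' n : ℕ, (n.factorial : ℝ≥0∞)⁻¹ * ∫⁻ x, splitterAdjoint F ⟨n, x⟩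
        ∂Measure.pi (fun _ : Fin n => lam) =
      ∫⁻ p, F p ∂(guichardetMeasure lam).prod (guichardetMeasure lam) := by
  rw [lintegral_prod_guichardetMeasure lam hF, tsum_tsum_eq_tsum_sum_range]
  refine tsum_congr fun n => ?_
  let I (m k : ℕ) : ℝ≥0∞ := ∫⁻ p, F (⟨m, p.1⟩, ⟨k, p.2⟩)
    ∂(Measure.pi fun _ : Fin m => lam).prod (Measure.pi fun _ : Fin k => lam)
  have hmk := measurable_comp_sigmaMk_prod hF
  have hI (S : Finset (Fin n)) (hk : Sᶜ.card = n - S.card) :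
      ∫⁻ x, F (⟨S.card, restrOf S rfl x⟩, ⟨n - S.card, restrOf Sᶜ hk x⟩)
        ∂Measure.pi (fun _ : Fin n => lam) = I S.card (n - S.card) :=
    (measurePreserving_restrOf lam S rfl hk).lintegral_comp (hmk _ _)
  have hsum : ∫⁻ x, splitterAdjoint F ⟨n, x⟩ ∂Measure.pi (fun _ : Fin n => lam) =
      ∑ S : Finset (Fin n), I S.card (n - S.card) := by
    change ∫⁻ x, ∑ S : Finset (Fin n), F (⟨S.card, restrOf S rfl x⟩,
      ⟨n - S.card, restrOf Sᶜ (by simp [Finset.card_compl]) x⟩) ∂Measure.pi (fun _ => lam) = _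
    rw [lintegral_finsetSum]
    · exact Finset.sum_congr rfl fun S _ => hI S _
    · exact fun S _ => (hmk _ _).comp
        (measurePreserving_restrOf lam S rfl (by simp [Finset.card_compl])).measurable
  rw [hsum, ← Finset.powerset_univ, Finset.sum_powerset_apply_card (fun m => I m (n - m)),
    Finset.mul_sum, Finset.card_univ, Fintype.card_fin]
  refine Finset.sum_congr rfl fun m hm => ?_
  rw [nsmul_eq_mul, ← mul_assoc, inv_factorial_mul_choose (Finset.mem_range_succ_iff.1 hm)]

theorem prodWeight_inv_restrOf {X : Type*} {n m : ℕ} (S : Finset (Fin n)) (hS : S.card = m)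
    (x : Fin n → X) (q : X → ℝ≥0) :
    prodWeight (fun y => (q y)⁻¹) ⟨m, restrOf S hS x⟩ = ((∏ i ∈ S, q (x i))⁻¹ : ℝ≥0) := by
  rw [← Finset.prod_inv_distrib, ENNReal.ofNNReal_finsetProd]
  exact prod_restrOf S hS x fun y => (((q y)⁻¹ : ℝ≥0) : ℝ≥0∞)

/-- The pointwise weighted Cauchy–Schwarz bound for the splitter adjoint. -/
theorem nnnorm_splitterAdjoint_sq_mul_prodWeight_le {X H : Type*} [SeminormedAddCommGroup H]
    {q₀ q₁ q : X → ℝ≥0} (hq₀ : ∀ x, 0 < q₀ x) (hq₁ : ∀ x, 0 < q₁ x)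
    (ψ : GS X × GS X → H) (ϑ : GS X) (hle : ∀ i, q₀ (ϑ.2 i) + q₁ (ϑ.2 i) ≤ q (ϑ.2 i)) :
    (‖splitterAdjoint ψ ϑ‖₊ : ℝ≥0∞) ^ 2 * prodWeight (fun x => (q x)⁻¹) ϑ ≤
      splitterAdjoint (fun p => (‖ψ p‖₊ : ℝ≥0∞) ^ 2 * prodWeight (fun x => (q₀ x)⁻¹) p.1 *
        prodWeight (fun x => (q₁ x)⁻¹) p.2) ϑ := by
  obtain ⟨n, x⟩ := ϑ
  have hw (S : Finset (Fin n)) : 0 < (∏ i ∈ S, q₀ (x i)) * ∏ i ∈ Sᶜ, q₁ (x i) :=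
    mul_pos (Finset.prod_pos fun i _ => hq₀ _) (Finset.prod_pos fun i _ => hq₁ _)
  have hsum : ∑ S : Finset (Fin n), (∏ i ∈ S, q₀ (x i)) * ∏ i ∈ Sᶜ, q₁ (x i) ≤
      ∏ i, q (x i) := by
    rw [← Fintype.prod_add]
    exact Finset.prod_le_prod' fun i _ => hle i
  have hprod : prodWeight (fun y => (q y)⁻¹) ⟨n, x⟩ = ((∏ i, q (x i))⁻¹ : ℝ≥0) := by
    rw [← Finset.prod_inv_distrib, ENNReal.ofNNReal_finsetProd]
    rfl
  rw [hprod]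
  simp only [splitterAdjoint, prodWeight_inv_restrOf]
  set f : Finset (Fin n) → H := fun S => ψ (⟨S.card, restrOf S rfl x⟩,
    ⟨n - S.card, restrOf Sᶜ (by simp [Finset.card_compl]) x⟩)
  have key : ‖∑ S, f S‖₊ ^ 2 * (∏ i, q (x i))⁻¹ ≤
      ∑ S, ‖f S‖₊ ^ 2 * (∏ i ∈ S, q₀ (x i))⁻¹ * (∏ i ∈ Sᶜ, q₁ (x i))⁻¹ := by
    simp only [← div_eq_mul_inv, div_div]
    refine le_trans ?_ (Finset.sq_sum_div_le_sum_sq_div _ _ fun S _ => hw S)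
    gcongr
    · exact Finset.sum_pos (fun S _ => hw S) Finset.univ_nonempty
    · exact nnnorm_sum_le _ _
  have hcast := ENNReal.coe_le_coe.2 key
  simpa only [ENNReal.coe_mul, ENNReal.coe_pow, ENNReal.ofNNReal_finsetSum] using hcast

/-- The adjoint `Δ*` of the multiple point splitter is a contraction from the tensor product of
the weighted Fock spaces with weights `q₀⁻¹`, `q₁⁻¹` into the weighted Fock space with weight
`q⁻¹`, for every `q ≥ q₀ + q₁`. -/
theorem stmt6 {X : Type*} [MeasurableSpace X] (lam : Measure X) [SigmaFinite lam]
    {H : Type*} [NormedAddCommGroup H] [InnerProductSpace ℂ H] [MeasurableSpace H] [BorelSpace H]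
    (q₀ q₁ q : X → ℝ≥0) (hq₀ : Measurable q₀) (hq₁ : Measurable q₁) (hq : Measurable q)
    (hq₀pos : ∀ x, 0 < q₀ x) (hq₁pos : ∀ x, 0 < q₁ x) (hqpos : ∀ x, 0 < q x)
    (hle : ∀ᵐ x ∂lam, q₀ x + q₁ x ≤ q x)
    (ψ : GS X × GS X → H)
    (hψ : Measurable ψ)
    (hψ₁ : ∀ κ : GS X, SymmFun fun υ => ψ (υ, κ))
    (hψ₂ : ∀ υ : GS X, SymmFun fun κ => ψ (υ, κ)) :
    ∫⁻ ϑ : GS X, (‖splitterAdjoint ψ ϑ‖₊ : ℝ≥0∞) ^ 2 * prodWeight (fun x => (q x)⁻¹) ϑ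
        ∂(guichardetMeasure lam)
      ≤ ∫⁻ p : GS X × GS X,
          (‖ψ p‖₊ : ℝ≥0∞) ^ 2 * prodWeight (fun x => (q₀ x)⁻¹) p.1 *
            prodWeight (fun x => (q₁ x)⁻¹) p.2
        ∂((guichardetMeasure lam).prod (guichardetMeasure lam)) := by
  have hF : Measurable fun p : GS X × GS X =>
      (‖ψ p‖₊ : ℝ≥0∞) ^ 2 * prodWeight (fun x => (q₀ x)⁻¹) p.1 *
        prodWeight (fun x => (q₁ x)⁻¹) p.2 :=
    ((hψ.nnnorm.coe_nnreal_ennreal.pow_const 2).mul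
      ((measurable_prodWeight hq₀.inv).comp measurable_fst)).mul
      ((measurable_prodWeight hq₁.inv).comp measurable_snd)
  rw [← tsum_lintegral_splitterAdjoint lam hF]
  refine (lintegral_guichardetMeasure_le lam _).trans (ENNReal.tsum_le_tsum fun n => ?_)
  gcongr _ * ?_
  refine lintegral_mono_ae ?_
  have hae : ∀ᵐ x ∂Measure.pi fun _ : Fin n => lam, ∀ i, q₀ (x i) + q₁ (x i) ≤ q (x i) :=
    ae_all_iff.2 fun i => (Measure.quasiMeasurePreserving_eval (fun _ => lam) i).ae hle
  filter_upwards [hae] with x hx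
  exact nnnorm_splitterAdjoint_sq_mul_prodWeight_le hq₀pos hq₁pos ψ ⟨n, x⟩ hx
end
end
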